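/- Let X be a closed densely defined operator affiliated with a finite von Neumann algebra M with faithful normal trace τ, and for a projection p let X♯(p) denote the range projection of Xp. Then X♯ restricts to a trace-preserving lattice isomorphism from {p : p ≤ dom-projection of X} onto {q : q ≤ range-projection of X}, and for any projection p, τ(X♯(p)) = τ(p) − τ(p ∧ ker-projection(X)). -/

import Mathlib

open scoped ComplexOrder

namespace Paper

variable {H : Type} [NormedAddCommGroup H] [InnerProductSpace ℂ H] [CompleteSpace H]

/-- `p` is an (orthogonal) projection operator. -/
def IsProj (p : H →L[ℂ] H) : Prop := IsIdempotentElem p ∧ IsSelfAdjoint p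

/-- `p` is a projection belonging to the von Neumann algebra `M`. -/
def IsProjection (M : VonNeumannAlgebra H) (p : H →L[ℂ] H) : Prop :=
  p ∈ M ∧ IsProj p

/-- The range of an operator, as a submodule. -/
def rng (p : H →L[ℂ] H) : Submodule ℂ H := LinearMap.range p.toLinearMap

/-- `r` is the lattice meet `p ∧ q` of projections: the orthogonal projection onto `pH ∩ qH`. -/
def IsMeetOf (r p q : H →L[ℂ] H) : Prop := IsProj r ∧ rng r = rng p ⊓ rng q

/-- `r` is the lattice join `p ∨ q` of projections:
the orthogonal projection onto the closure of `pH + qH`. -/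
def IsJoinOf (r p q : H →L[ℂ] H) : Prop :=
  IsProj r ∧ rng r = (rng p ⊔ rng q).topologicalClosure

/-- A faithful tracial state on a von Neumann algebra, making it a finite von Neumann algebra. -/
structure TracialState (M : VonNeumannAlgebra H) where
  τ : (H →L[ℂ] H) → ℂ
  map_add : ∀ a b : H →L[ℂ] H, τ (a + b) = τ a + τ b
  map_smul : ∀ (c : ℂ) (a : H →L[ℂ] H), τ (c • a) = c * τ a
  tracial : ∀ a b : H →L[ℂ] H, a ∈ M → b ∈ M → τ (a * b) = τ (b * a)
  pos : ∀ a : H →L[ℂ] H, a ∈ M → 0 ≤ τ (star a * a)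
  faithful : ∀ a : H →L[ℂ] H, a ∈ M → τ (star a * a) = 0 → a = 0
  normalized : τ 1 = 1

/-- `M` is diffuse: it has no minimal nonzero projections. -/
def Diffuse (M : VonNeumannAlgebra H) : Prop :=
  ∀ p : H →L[ℂ] H, IsProjection M p → p ≠ 0 →
    ∃ q : H →L[ℂ] H, IsProjection M q ∧ rng q ≤ rng p ∧ q ≠ 0 ∧ q ≠ p

end Paper

namespace Paper

variable {H : Type} [NormedAddCommGroup H] [InnerProductSpace ℂ H] [CompleteSpace H]

/-- A closed densely defined operator `X` (given as a partially defined linear map) is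
affiliated with `M` if every unitary in the commutant of `M` leaves its domain invariant and
commutes with it. -/
def Affiliated (M : VonNeumannAlgebra H) (X : H →ₗ.[ℂ] H) : Prop :=
  Dense (X.domain : Set H) ∧ IsClosed (X.graph : Set (H × H)) ∧
    ∀ u : H →L[ℂ] H, u ∈ M.commutant → u * star u = 1 → star u * u = 1 →
      ∀ x : X.domain, ∃ h : u (x : H) ∈ X.domain, X ⟨u (x : H), h⟩ = u (X x)

/-- The kernel of a partially defined operator, as a subset of `H`. -/
def kernelSet (X : H →ₗ.[ℂ] H) : Set H := {x | ∃ h : x ∈ X.domain, X ⟨x, h⟩ = 0}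

/-- The image of a set `S` under a partially defined operator. -/
def imageSet (X : H →ₗ.[ℂ] H) (S : Set H) : Set H :=
  {y | ∃ x : X.domain, (x : H) ∈ S ∧ X x = y}

/-- `k` is the kernel projection of `X`: the projection onto `ker X`. -/
def IsKerProj (X : H →ₗ.[ℂ] H) (k : H →L[ℂ] H) : Prop :=
  IsProj k ∧ (rng k : Set H) = kernelSet X

/-- `R` is the range projection of `X`: the projection onto the closure of `ran X`. -/
def IsRanProj (X : H →ₗ.[ℂ] H) (R : H →L[ℂ] H) : Prop :=
  IsProj R ∧ (rng R : Set H) = closure (imageSet X Set.univ)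

/-- `q = X♯(p)`: `q` is the range projection of `Xp`, i.e. the projection onto the closure
of `X(pH ∩ dom X)`. -/
def IsSharp (X : H →ₗ.[ℂ] H) (p q : H →L[ℂ] H) : Prop :=
  IsProj q ∧ (rng q : Set H) = closure (imageSet X (rng p : Set H))

end Paper

/-- A faithful positive trace on the commutant of a self-adjoint set of bounded operators. -/
structure CommutantTrace (K : Type*) [NormedAddCommGroup K] [InnerProductSpace ℂ K]
    [CompleteSpace K] where
  /-- the self-adjoint set whose commutant carries the trace -/
  gens : Set (K →L[ℂ] K)
  star_mem : ∀ b ∈ gens, star b ∈ gens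
  /-- the trace, extended additively to all bounded operators -/
  tr : (K →L[ℂ] K) →+ ℂ
  tracial : ∀ a b, a ∈ Subring.centralizer gens → b ∈ Subring.centralizer gens →
    tr (a * b) = tr (b * a)
  pos : ∀ a, a ∈ Subring.centralizer gens → 0 ≤ tr (star a * a)
  faithful : ∀ a, a ∈ Subring.centralizer gens → tr (star a * a) = 0 → a = 0

section Closure

variable {K : Type*} [NormedAddCommGroup K] [InnerProductSpace ℂ K] [CompleteSpace K]

/-- The orthogonal projection onto the closure of a subspace. -/
noncomputable def closureProj (S : Submodule ℂ K) : K →L[ℂ] K :=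
  S.topologicalClosure.starProjection

lemma isStarProjection_closureProj (S : Submodule ℂ K) : IsStarProjection (closureProj S) :=
  isStarProjection_starProjection

lemma star_closureProj (S : Submodule ℂ K) : star (closureProj S) = closureProj S :=
  (isStarProjection_closureProj S).isSelfAdjoint

lemma closureProj_mul_self (S : Submodule ℂ K) :
    closureProj S * closureProj S = closureProj S :=
  (isStarProjection_closureProj S).isIdempotentElem

lemma closureProj_apply_mem (S : Submodule ℂ K) (x : K) :
    closureProj S x ∈ S.topologicalClosure :=
  Submodule.starProjection_apply_mem _ x

lemma closureProj_apply_eq_self {S : Submodule ℂ K} {x : K} (hx : x ∈ S.topologicalClosure) :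
    closureProj S x = x :=
  Submodule.starProjection_eq_self_iff.mpr hx

lemma closureProj_apply_eq_zero_iff {S : Submodule ℂ K} {x : K} :
    closureProj S x = 0 ↔ x ∈ Sᗮ := by
  rw [closureProj, Submodule.starProjection_apply_eq_zero_iff, Submodule.orthogonal_closure]

lemma sub_closureProj_apply_mem (S : Submodule ℂ K) (x : K) : x - closureProj S x ∈ Sᗮ := by
  rw [← Submodule.orthogonal_closure]
  exact Submodule.sub_starProjection_mem_orthogonal x

lemma closureProj_apply_eq {S : Submodule ℂ K} {x v : K} (hv : v ∈ S.topologicalClosure)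
    (h : x - v ∈ Sᗮ) : closureProj S x = v := by
  rw [← Submodule.orthogonal_closure] at h
  exact Submodule.eq_starProjection_of_mem_orthogonal hv h

lemma closureProj_mul_of_le {S S' : Submodule ℂ K} (h : S ≤ S'.topologicalClosure) :
    closureProj S' * closureProj S = closureProj S := by
  ext x
  exact closureProj_apply_eq_self
    (S.topologicalClosure_minimal h S'.isClosed_topologicalClosure (closureProj_apply_mem S x))

lemma closureProj_mul_of_le' {S S' : Submodule ℂ K} (h : S ≤ S'.topologicalClosure) :
    closureProj S * closureProj S' = closureProj S := by
  have := congrArg star (closureProj_mul_of_le h)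
  rwa [star_mul, star_closureProj, star_closureProj] at this

lemma closureProj_eq_of_closure_eq {S S' : Submodule ℂ K}
    (h : S.topologicalClosure = S'.topologicalClosure) : closureProj S = closureProj S' := by
  unfold closureProj
  congr!

omit [CompleteSpace K] in
lemma topologicalClosure_eq_self {S : Submodule ℂ K} (h : IsClosed (S : Set K)) :
    S.topologicalClosure = S :=
  h.submodule_topologicalClosure_eq

lemma IsStarProjection.eq_closureProj {p : K →L[ℂ] K} (hp : IsStarProjection p)
    {S : Submodule ℂ K} (h : LinearMap.range p.toLinearMap = S.topologicalClosure) :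
    p = closureProj S := by
  rw [isStarProjection_iff_eq_starProjection_range] at hp
  obtain ⟨_, hp⟩ := hp
  rw [hp]
  unfold closureProj
  congr!

lemma IsStarProjection.eq_of_ker {s r : K →L[ℂ] K} (hs : IsStarProjection s)
    (hr : IsStarProjection r) (h : ∀ x, s x = 0 ↔ r x = 0) : s = r := by
  have key : ∀ {s r : K →L[ℂ] K}, IsStarProjection s → IsStarProjection r →
      (∀ x, r x = 0 → s x = 0) → s = s * r := by
    intro s r _ hr h
    ext x
    have h0 : s (x - r x) = 0 := h _ (by
      have := congr($(hr.isIdempotentElem.eq) x)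
      simp only [mul_apply_eq_comp] at this
      simp [this])
    simpa [sub_eq_zero] using h0
  have h1 := key hs hr fun x => (h x).2
  have h2 := congrArg star (key hr hs fun x => (h x).1)
  rw [star_mul, hs.isSelfAdjoint.star_eq, hr.isSelfAdjoint.star_eq] at h2
  rw [h1, ← h2]

end Closure

section Polar

variable {K : Type*} [NormedAddCommGroup K] [InnerProductSpace ℂ K] [CompleteSpace K]

/-- An operator `a` factors through any operator `c` with `‖a x‖ ≤ ‖c x‖`. -/
lemma exists_mul_eq_of_norm_le {a c : K →L[ℂ] K} (h : ∀ x, ‖a x‖ ≤ ‖c x‖) :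
    ∃ u : K →L[ℂ] K, u * c = a := by
  let E := (LinearMap.range c.toLinearMap).topologicalClosure
  let e : K →ₗ[ℂ] E := c.toLinearMap.codRestrict E fun x =>
    Submodule.le_topologicalClosure _ (LinearMap.mem_range_self _ x)
  have hd : DenseRange e := by
    intro y
    rw [closure_subtype]
    have : (Subtype.val '' Set.range e : Set K) = LinearMap.range c.toLinearMap := by
      ext z
      simp [e]
    rw [this]
    exact y.2
  refine ⟨(a.toLinearMap.extendOfNorm e).comp E.orthogonalProjectionOnto, ?_⟩
  ext x
  have hx : E.orthogonalProjectionOnto (c x) = e x := by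
    have := E.orthogonalProjectionOnto_mem_subspace_eq_self (e x)
    exact this
  have := LinearMap.extendOfNorm_eq (f := a.toLinearMap) hd ⟨1, fun x => by simpa [e] using h x⟩ x
  simp only [mul_apply_eq_comp, ContinuousLinearMap.comp_apply, hx]
  exact this

end Polar

section Trace

variable {K : Type*} [NormedAddCommGroup K] [InnerProductSpace ℂ K] [CompleteSpace K]

namespace CommutantTrace

variable (T : CommutantTrace K)

/-- The commutant carrying the trace. -/
def comm : Subring (K →L[ℂ] K) := Subring.centralizer T.gens

/-- Invariance of a subspace under the operators in `T.gens`. -/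
def Inv (S : Submodule ℂ K) : Prop := ∀ b ∈ T.gens, ∀ x ∈ S, b x ∈ S

/-- The dimension of (the closure of) a subspace relative to the trace. -/
noncomputable def dim (S : Submodule ℂ K) : ℝ := (T.tr (closureProj S)).re

variable {T}

lemma mem_comm {a : K →L[ℂ] K} : a ∈ T.comm ↔ ∀ b ∈ T.gens, b * a = a * b :=
  Subring.mem_centralizer_iff

lemma star_mem_comm {a : K →L[ℂ] K} (ha : a ∈ T.comm) : star a ∈ T.comm := by
  rw [mem_comm] at ha ⊢
  intro b hb
  simpa using (congrArg star (ha _ (T.star_mem b hb))).symm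

lemma tr_eq_of_ker {a s r : K →L[ℂ] K} (ha : a ∈ T.comm) (hs : IsStarProjection s)
    (hr : IsStarProjection r) (hsT : s ∈ T.comm)
    (hsa : ∀ x, s x = 0 ↔ a x = 0) (hra : ∀ x, r x = 0 ↔ star a x = 0) :
    T.tr s = T.tr r := by
  set A := CFC.abs a with hA
  have hAA : A * A = star a * a := CFC.abs_mul_abs a
  have hAs : star A = A := (CFC.abs_nonneg a).isSelfAdjoint
  have hnorm : ∀ x, ‖A x‖ = ‖a x‖ := by
    intro x
    have h := congr(inner ℂ ($hAA x) x)
    nth_rw 1 [← hAs] at h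
    simp only [mul_apply_eq_comp, ContinuousLinearMap.star_eq_adjoint,
      ContinuousLinearMap.adjoint_inner_left,
      inner_self_eq_norm_sq_to_K] at h
    have h' : ‖A x‖ ^ 2 = ‖a x‖ ^ 2 := by exact_mod_cast h
    exact (pow_left_inj₀ (norm_nonneg _) (norm_nonneg _) two_ne_zero).1 h'
  have hker : ∀ x, s x = 0 ↔ A x = 0 := fun x => by
    rw [hsa, ← norm_eq_zero, ← hnorm, norm_eq_zero]
  have cancel : ∀ {y : K →L[ℂ] K}, A * y = 0 → s * y = 0 := fun {y} h => by
    ext x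
    exact (hker _).2 (congr($h x))
  have hss : s * s = s := hs.isIdempotentElem
  have hsst : star s = s := hs.isSelfAdjoint
  have hAs1 : A * s = A := by
    have : A * (1 - s) = 0 := by
      ext x
      refine (hker _).1 ?_
      have : s * (1 - s) = 0 := by rw [mul_sub, hss, mul_one, sub_self]
      exact congr($this x)
    rw [mul_sub, mul_one, sub_eq_zero] at this
    exact this.symm
  have hsA : s * A = A := by
    have := congrArg star hAs1
    rwa [star_mul, hAs, hsst] at this
  obtain ⟨u, hu, hus⟩ : ∃ u : K →L[ℂ] K, u * A = a ∧ u * s = u := by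
    obtain ⟨u, hu⟩ := exists_mul_eq_of_norm_le fun x => (hnorm x).ge
    exact ⟨u * s, by rw [mul_assoc, hsA, hu], by rw [mul_assoc, hss]⟩
  have hsu : s * star u = star u := by
    have := congrArg star hus
    rwa [star_mul, hsst] at this
  have huA : A * star u = star a := by
    have := congrArg star hu
    rwa [star_mul, hAs] at this
  have huu : star u * u = s := by
    have h1 : s * (star u * u * A - A) = 0 := cancel (by
      rw [mul_sub, hAA, mul_assoc, hu, ← mul_assoc, huA, sub_self])
    rw [mul_sub, hsA, ← mul_assoc, ← mul_assoc, hsu, sub_eq_zero] at h1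
    have h2 := congrArg star h1
    rw [star_mul, star_mul, star_star, hAs] at h2
    have h3 := cancel (y := star u * u - s) (by rw [mul_sub, h2, hAs1, sub_self])
    rwa [mul_sub, hss, ← mul_assoc, hsu, sub_eq_zero] at h3
  have hur : u * star u = r := by
    refine IsStarProjection.eq_of_ker ⟨?_, ?_⟩ hr fun x => ?_
    · rw [IsIdempotentElem, mul_assoc, ← mul_assoc (star u), huu, hsu]
    · rw [IsSelfAdjoint, star_mul, star_star]
    rw [hra, ← huA]
    constructor
    · intro h
      have h' : (star u * (u * star u)) x = 0 := by
        rw [mul_apply_eq_comp, h, map_zero]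
      rw [← mul_assoc, huu, hsu] at h'
      rw [mul_apply_eq_comp, h', map_zero]
    · intro h
      have h' : star u x = 0 := by
        rw [← hsu]
        exact (hker _).2 h
      rw [mul_apply_eq_comp, h', map_zero]
  have hmem : u ∈ T.comm := by
    rw [mem_comm]
    intro b hb
    have hba := mem_comm.1 ha b hb
    have hbs := mem_comm.1 hsT b hb
    have hbA : Commute b A := Commute.cfcAbs_right hba.symm
      (mem_comm.1 ha _ (T.star_mem b hb)).symm
    have h1 : (b * u - u * b) * A = 0 := by
      rw [sub_mul, mul_assoc, hu, mul_assoc, hbA.eq, ← mul_assoc, hu, hba, sub_self]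
    have h2 := congrArg star h1
    rw [star_mul, hAs, star_zero] at h2
    have h3 := congrArg star (cancel h2)
    rw [star_mul, star_star, hsst, star_zero, sub_mul, mul_assoc, hus, mul_assoc, hbs,
      ← mul_assoc, hus] at h3
    exact sub_eq_zero.1 h3
  rw [← huu, ← hur]
  exact T.tracial _ _ (star_mem_comm hmem) hmem

lemma Inv.closureProj_mem {S : Submodule ℂ K} (h : T.Inv S) : closureProj S ∈ T.comm := by
  have hcl : ∀ b ∈ T.gens, ∀ x ∈ S.topologicalClosure, b x ∈ S.topologicalClosure := by
    intro b hb x hx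
    exact map_mem_closure b.continuous hx (h b hb)
  have key : ∀ b ∈ T.gens, closureProj S * b * closureProj S = b * closureProj S := by
    intro b hb
    ext x
    exact closureProj_apply_eq_self (hcl b hb _ (closureProj_apply_mem S x))
  rw [mem_comm]
  intro b hb
  rw [← key b hb]
  have := congrArg star (key _ (T.star_mem b hb))
  simpa [star_mul, star_closureProj, mul_assoc] using this

lemma dim_nonneg_and_eq {p : K →L[ℂ] K} (hp : IsStarProjection p) (h : p ∈ T.comm) :
    0 ≤ (T.tr p).re ∧ T.tr p = ((T.tr p).re : ℂ) ∧ ((T.tr p).re = 0 → p = 0) := by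
  have hpp : star p * p = p := by rw [hp.isSelfAdjoint.star_eq, hp.isIdempotentElem]
  have h0 := T.pos p h
  have hf := T.faithful p h
  rw [hpp] at h0 hf
  obtain ⟨h1, h2⟩ := Complex.nonneg_iff.1 h0
  have h3 : T.tr p = ((T.tr p).re : ℂ) := Complex.ext rfl (by simpa using h2.symm)
  exact ⟨h1, h3, fun h => hf (by rw [h3, h, Complex.ofReal_zero])⟩

lemma Inv.tr_eq {S : Submodule ℂ K} (h : T.Inv S) : T.tr (closureProj S) = T.dim S :=
  (dim_nonneg_and_eq (isStarProjection_closureProj S) h.closureProj_mem).2.1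

lemma isStarProjection_sub {S S' : Submodule ℂ K} (h : S ≤ S'.topologicalClosure) :
    IsStarProjection (closureProj S' - closureProj S) := by
  refine ⟨?_, ?_⟩
  · rw [IsIdempotentElem, mul_sub, sub_mul, sub_mul, closureProj_mul_self, closureProj_mul_self,
      closureProj_mul_of_le h, closureProj_mul_of_le' h]
    abel
  · rw [IsSelfAdjoint, star_sub, star_closureProj, star_closureProj]

lemma dim_mono {S S' : Submodule ℂ K} (hS : T.Inv S) (hS' : T.Inv S')
    (h : S ≤ S'.topologicalClosure) : T.dim S ≤ T.dim S' := by
  have := (dim_nonneg_and_eq (isStarProjection_sub h)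
    (T.comm.sub_mem hS'.closureProj_mem hS.closureProj_mem)).1
  rw [map_sub, Complex.sub_re] at this
  exact sub_nonneg.1 this

lemma le_closure_of_dim_le {S S' : Submodule ℂ K} (hS : T.Inv S) (hS' : T.Inv S')
    (h : S ≤ S'.topologicalClosure) (hd : T.dim S' ≤ T.dim S) : S' ≤ S.topologicalClosure := by
  have h0 := (dim_nonneg_and_eq (isStarProjection_sub h)
    (T.comm.sub_mem hS'.closureProj_mem hS.closureProj_mem)).2.2
  have h1 : T.dim S' = T.dim S := hd.antisymm (dim_mono hS hS' h)
  rw [map_sub, Complex.sub_re, sub_eq_zero, sub_eq_zero] at h0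
  intro x hx
  have h2 := congr($(h0 h1) x)
  rw [closureProj_apply_eq_self (S'.le_topologicalClosure hx)] at h2
  rw [h2]
  exact closureProj_apply_mem S x

lemma dim_congr {S S' : Submodule ℂ K} (h : S.topologicalClosure = S'.topologicalClosure) :
    T.dim S = T.dim S' := by
  rw [dim, dim, closureProj_eq_of_closure_eq h]

lemma Inv.inf {S S' : Submodule ℂ K} (hS : T.Inv S) (hS' : T.Inv S') : T.Inv (S ⊓ S') :=
  fun b hb x hx => ⟨hS b hb x hx.1, hS' b hb x hx.2⟩

lemma Inv.sup {S S' : Submodule ℂ K} (hS : T.Inv S) (hS' : T.Inv S') : T.Inv (S ⊔ S') := by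
  intro b hb x hx
  obtain ⟨y, hy, z, hz, rfl⟩ := Submodule.mem_sup.1 hx
  rw [map_add]
  exact Submodule.add_mem_sup (hS b hb y hy) (hS' b hb z hz)

lemma Inv.closure {S : Submodule ℂ K} (hS : T.Inv S) : T.Inv S.topologicalClosure :=
  fun b hb _ hx => map_mem_closure b.continuous hx (hS b hb)

lemma dim_inf_add_dim_sup {S S' : Submodule ℂ K} (hS : T.Inv S) (hS' : T.Inv S')
    (hc : IsClosed (S : Set K)) (hc' : IsClosed (S' : Set K)) :
    T.dim (S ⊓ S') + T.dim (S ⊔ S') = T.dim S + T.dim S' := by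
  set P := closureProj S with hP
  set Q := closureProj S' with hQ
  set e := closureProj (S ⊓ S') with he
  set f := closureProj (S ⊔ S') with hf
  have hPT : P ∈ T.comm := hS.closureProj_mem
  have hQT : Q ∈ T.comm := hS'.closureProj_mem
  have heT : e ∈ T.comm := (hS.inf hS').closureProj_mem
  have hle : S ⊓ S' ≤ S.topologicalClosure := inf_le_left.trans S.le_topologicalClosure
  have hle2 : S ⊓ S' ≤ S'.topologicalClosure := inf_le_right.trans S'.le_topologicalClosure
  have hge : S' ≤ (S ⊔ S').topologicalClosure := le_sup_right.trans (Submodule.le_topologicalClosure _)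
  have hge2 : S ≤ (S ⊔ S').topologicalClosure := le_sup_left.trans (Submodule.le_topologicalClosure _)
  have hPf : ∀ x, P (f x) = P x := fun x => congr($(closureProj_mul_of_le' hge2) x)
  have hfQ : ∀ x, f (Q x) = Q x := fun x => congr($(closureProj_mul_of_le hge) x)
  have hQe : ∀ x, Q (e x) = e x := fun x => congr($(closureProj_mul_of_le hle2) x)
  have heP : ∀ x, e (P x) = e x := fun x => congr($(closureProj_mul_of_le' hle) x)
  have key : T.tr (P - e) = T.tr (f - Q) := by
    refine tr_eq_of_ker (a := (1 - Q) * P)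
      (T.comm.mul_mem (T.comm.sub_mem T.comm.one_mem hQT) hPT)
      (isStarProjection_sub hle) (isStarProjection_sub hge)
      (T.comm.sub_mem hPT heT) (fun x => ?_) (fun x => ?_)
    · simp only [mul_apply_eq_comp, sub_apply,
        one_apply_eq_self, sub_eq_zero]
      constructor
      · intro h
        rw [h, hQe]
      · intro h
        have h1 : P x ∈ S := by
          have := closureProj_apply_mem S x
          rwa [topologicalClosure_eq_self hc] at this
        have h2 : P x ∈ S' := by
          have := closureProj_apply_mem S' (P x)
          rwa [topologicalClosure_eq_self hc', ← hQ, ← h] at this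
        rw [← heP]
        exact (closureProj_apply_eq_self (Submodule.le_topologicalClosure _ (Submodule.mem_inf.2 ⟨h1, h2⟩))).symm
    · rw [star_mul, star_sub, star_one, star_closureProj, star_closureProj]
      simp only [mul_apply_eq_comp, sub_apply,
        one_apply_eq_self, sub_eq_zero]
      constructor
      · intro h
        rw [map_sub, sub_eq_zero, ← hPf, h]
      · intro h
        have h1 : x - Q x ∈ (S ⊔ S')ᗮ := by
          rw [← Submodule.inf_orthogonal]
          exact ⟨closureProj_apply_eq_zero_iff.1 h, sub_closureProj_apply_mem S' x⟩
        have h2 := closureProj_apply_eq_zero_iff.2 h1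
        rwa [← hf, map_sub, hfQ, sub_eq_zero] at h2
  have := congrArg Complex.re key
  simp only [map_sub, Complex.sub_re] at this
  simp only [dim]
  linarith

end CommutantTrace

end Trace

section Amplification

variable {H : Type*} [NormedAddCommGroup H] [InnerProductSpace ℂ H] [CompleteSpace H]
variable {ι : Type*} [Fintype ι] [DecidableEq ι]

/-- The `i`-th coordinate map on a finite Hilbert sum of copies of `H`. -/
noncomputable def coord (i : ι) : PiLp 2 (fun _ : ι => H) →L[ℂ] H :=
  PiLp.proj 2 (fun _ : ι => H) i

/-- The `i`-th coordinate inclusion into a finite Hilbert sum of copies of `H`. -/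
noncomputable def incl (i : ι) : H →L[ℂ] PiLp 2 (fun _ : ι => H) :=
  ContinuousLinearMap.adjoint (coord i)

omit [CompleteSpace H] [Fintype ι] [DecidableEq ι] in
lemma coord_apply (i : ι) (w : PiLp 2 (fun _ : ι => H)) : coord i w = w i := rfl

lemma incl_apply (i : ι) (x : H) : incl i x = PiLp.single 2 i x := by
  refine ext_inner_left ℂ fun w => ?_
  rw [incl, ContinuousLinearMap.adjoint_inner_right, PiLp.inner_apply, coord_apply,
    Finset.sum_eq_single i]
  · simp
  · intro j _ hj
    simp [hj]
  · simp

lemma coord_incl (i j : ι) (x : H) : coord j (incl i x) = if j = i then x else 0 := by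
  rw [incl_apply, coord_apply]
  split_ifs with h
  · subst h
    simp
  · simp [h]

lemma sum_incl_coord (w : PiLp 2 (fun _ : ι => H)) : ∑ i, incl i (coord i w) = w := by
  ext j
  rw [← coord_apply, ← coord_apply, map_sum]
  simp only [coord_incl]
  simp

lemma coord_surjective (i : ι) : Function.Surjective (coord (H := H) i) := fun x =>
  ⟨incl i x, by simp [coord_incl]⟩

/-- The matrix entries of an operator on a finite Hilbert sum of copies of `H`. -/
noncomputable def entry (i j : ι) (a : PiLp 2 (fun _ : ι => H) →L[ℂ] PiLp 2 (fun _ : ι => H)) :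
    H →L[ℂ] H :=
  coord i ∘L a ∘L incl j

omit [DecidableEq ι] in
lemma entry_apply (i j : ι) (a : PiLp 2 (fun _ : ι => H) →L[ℂ] PiLp 2 (fun _ : ι => H)) (x : H) :
    entry i j a x = coord i (a (incl j x)) := rfl

lemma entry_mul (i j : ι) (a b : PiLp 2 (fun _ : ι => H) →L[ℂ] PiLp 2 (fun _ : ι => H)) :
    entry i j (a * b) = ∑ k, entry i k a * entry k j b := by
  ext x
  simp only [sum_apply, mul_apply_eq_comp, entry_apply, ← map_sum,
    sum_incl_coord]

omit [DecidableEq ι] in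
lemma entry_star (i j : ι) (a : PiLp 2 (fun _ : ι => H) →L[ℂ] PiLp 2 (fun _ : ι => H)) :
    entry i j (star a) = star (entry j i a) := by
  refine (ContinuousLinearMap.eq_adjoint_iff _ _).2 fun x y => ?_
  simp only [entry_apply, ContinuousLinearMap.star_eq_adjoint]
  rw [← ContinuousLinearMap.adjoint_inner_right, ContinuousLinearMap.adjoint_inner_left]
  change inner ℂ (incl j x) (a (incl i y)) = _
  rw [incl, ContinuousLinearMap.adjoint_inner_left]

lemma ext_entry {a b : PiLp 2 (fun _ : ι => H) →L[ℂ] PiLp 2 (fun _ : ι => H)}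
    (h : ∀ i j, entry i j a = entry i j b) : a = b := by
  ext w i
  rw [← sum_incl_coord w, map_sum, map_sum, ← coord_apply, ← coord_apply, map_sum, map_sum]
  exact Finset.sum_congr rfl fun j _ => congr($(h i j) (coord j w))

/-- The diagonal amplification of an operator. -/
noncomputable def diag (ι : Type*) [Fintype ι] [DecidableEq ι] (b : H →L[ℂ] H) :
    PiLp 2 (fun _ : ι => H) →L[ℂ] PiLp 2 (fun _ : ι => H) :=
  ∑ i, incl i ∘L b ∘L coord i

lemma coord_diag (i : ι) (b : H →L[ℂ] H) (w : PiLp 2 (fun _ : ι => H)) :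
    coord i (diag ι b w) = b (coord i w) := by
  simp only [diag, sum_apply, map_sum, ContinuousLinearMap.comp_apply,
    coord_incl]
  simp

lemma diag_incl (i : ι) (b : H →L[ℂ] H) (x : H) : diag ι b (incl i x) = incl i (b x) := by
  ext j
  rw [← coord_apply, ← coord_apply, coord_diag, coord_incl, coord_incl]
  split_ifs <;> simp

lemma star_diag (b : H →L[ℂ] H) : star (diag ι b) = diag ι (star b) := by
  refine ext_entry fun i j => ?_
  rw [entry_star]
  have key : ∀ (c : H →L[ℂ] H) (i j : ι), entry i j (diag ι c) = if i = j then c else 0 := by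
    intro c i j
    ext x
    rw [entry_apply, coord_diag, coord_incl]
    split_ifs <;> simp
  rw [key, key]
  simp only [eq_comm (a := i)]
  split_ifs <;> simp

lemma entry_mem_comm {T : CommutantTrace H}
    {a : PiLp 2 (fun _ : ι => H) →L[ℂ] PiLp 2 (fun _ : ι => H)}
    (ha : a ∈ Subring.centralizer (diag ι '' T.gens)) (i j : ι) : entry i j a ∈ T.comm := by
  rw [CommutantTrace.mem_comm]
  intro b hb
  have h := Subring.mem_centralizer_iff.1 ha _ ⟨b, hb, rfl⟩
  ext x
  have h' := congr(coord i ($h (incl j x)))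
  simp only [mul_apply_eq_comp, coord_diag, diag_incl] at h'
  exact h'

namespace CommutantTrace

/-- The trace on matrices over the commutant. -/
noncomputable def matrix (T : CommutantTrace H) (ι : Type*) [Fintype ι] [DecidableEq ι] :
    CommutantTrace (PiLp 2 (fun _ : ι => H)) where
  gens := diag ι '' T.gens
  star_mem := by
    rintro _ ⟨b, hb, rfl⟩
    exact ⟨star b, T.star_mem b hb, (star_diag b).symm⟩
  tr :=
    { toFun := fun a => ∑ i, T.tr (entry i i a)
      map_zero' := by
        have : ∀ i : ι, entry i i (0 : PiLp 2 (fun _ : ι => H) →L[ℂ] _) = 0 := fun i => by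
          ext x; simp [entry_apply]
        simp [this]
      map_add' := fun a b => by
        have : ∀ i : ι, entry i i (a + b) = entry i i a + entry i i b := fun i => by
          ext x; simp [entry_apply]
        simp [this, Finset.sum_add_distrib] }
  tracial := fun a b ha hb => by
    simp only [AddMonoidHom.coe_mk, ZeroHom.coe_mk, entry_mul, map_sum]
    rw [Finset.sum_comm]
    exact Finset.sum_congr rfl fun i _ => Finset.sum_congr rfl fun j _ =>
      T.tracial _ _ (entry_mem_comm ha _ _) (entry_mem_comm hb _ _)
  pos := fun a ha => by
    simp only [AddMonoidHom.coe_mk, ZeroHom.coe_mk, entry_mul, map_sum, entry_star]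
    exact Finset.sum_nonneg fun i _ => Finset.sum_nonneg fun j _ =>
      T.pos _ (entry_mem_comm ha _ _)
  faithful := fun a ha h => by
    simp only [AddMonoidHom.coe_mk, ZeroHom.coe_mk, entry_mul, map_sum, entry_star] at h
    have hp : ∀ i j : ι, 0 ≤ T.tr (star (entry j i a) * entry j i a) := fun i j =>
      T.pos _ (entry_mem_comm ha _ _)
    refine ext_entry fun i j => ?_
    have h1 := (Finset.sum_eq_zero_iff_of_nonneg fun i _ => Finset.sum_nonneg fun j _ => hp i j).1
      h j (Finset.mem_univ _)
    have h2 := (Finset.sum_eq_zero_iff_of_nonneg fun k _ => hp j k).1 h1 i (Finset.mem_univ _)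
    rw [T.faithful _ (entry_mem_comm ha _ _) h2]
    ext x
    simp [entry_apply]

variable {T : CommutantTrace H}

lemma matrix_tr_apply (a : PiLp 2 (fun _ : ι => H) →L[ℂ] PiLp 2 (fun _ : ι => H)) :
    (T.matrix ι).tr a = ∑ i, T.tr (entry i i a) := rfl

lemma Inv.comap_coord {S : Submodule ℂ H} (hS : T.Inv S) (i : ι) :
    (T.matrix ι).Inv (S.comap (coord i).toLinearMap) := by
  rintro _ ⟨b, hb, rfl⟩ w hw
  exact (congrArg (· ∈ S) (coord_diag i b w)).mpr (hS b hb _ hw)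

lemma Inv.map_coord {Γ : Submodule ℂ (PiLp 2 (fun _ : ι => H))} (hΓ : (T.matrix ι).Inv Γ) (i : ι) :
    T.Inv (Γ.map (coord i).toLinearMap) := by
  rintro b hb _ ⟨w, hw, rfl⟩
  exact ⟨diag ι b w, hΓ _ ⟨b, hb, rfl⟩ w hw, coord_diag i b w⟩

lemma inv_bot : T.Inv ⊥ := fun b _ x hx => by
  rw [Submodule.mem_bot] at hx ⊢
  rw [hx, map_zero]

lemma topologicalClosure_comap_coord (S : Submodule ℂ H) (i : ι) :
    (S.comap (coord i).toLinearMap).topologicalClosure =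
      S.topologicalClosure.comap (coord i).toLinearMap := by
  refine SetLike.coe_injective ?_
  exact (((coord (H := H) i).isOpenMap (coord_surjective i)).preimage_closure_eq_closure_preimage
    (coord i).continuous _).symm

lemma dim_comap_coord (S : Submodule ℂ H) (i : ι) :
    (T.matrix ι).dim (S.comap (coord i).toLinearMap) =
      ((T.matrix ι).tr 1).re - (T.tr 1).re + T.dim S := by
  have h : closureProj (S.comap (coord i).toLinearMap) =
      1 - incl i ∘L (1 - closureProj S) ∘L coord i := by
    ext1 w
    refine closureProj_apply_eq ?_ ?_
    · rw [topologicalClosure_comap_coord, Submodule.mem_comap]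
      have : coord i ((1 - incl i ∘L (1 - closureProj S) ∘L coord i :
          PiLp 2 (fun _ : ι => H) →L[ℂ] _) w) = closureProj S (coord i w) := by
        simp [coord_incl]
      exact this ▸ closureProj_apply_mem S _
    · rw [Submodule.mem_orthogonal]
      intro u hu
      have := (Submodule.mem_orthogonal _ _).1 (sub_closureProj_apply_mem S (coord i w)) _ hu
      have hw : w - (1 - incl i ∘L (1 - closureProj S) ∘L coord i :
          PiLp 2 (fun _ : ι => H) →L[ℂ] _) w = incl i (coord i w - closureProj S (coord i w)) := by
        simp
      rwa [hw, incl, ContinuousLinearMap.adjoint_inner_right]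
  have h2 : (T.matrix ι).tr (incl i ∘L (1 - closureProj S) ∘L coord i) =
      T.tr (1 - closureProj S) := by
    rw [matrix_tr_apply, Finset.sum_eq_single i]
    · congr 1
      ext x
      simp [entry_apply, coord_incl]
    · intro j _ hj
      rw [← map_zero T.tr]
      congr 1
      ext x
      simp [entry_apply, coord_incl, hj]
    · simp
  rw [dim, h, map_sub, h2, map_sub, dim, Complex.sub_re, Complex.sub_re]
  ring

lemma dim_bot : T.dim ⊥ = 0 := by
  have : closureProj (⊥ : Submodule ℂ H) = 0 := by
    ext x
    exact closureProj_apply_eq_zero_iff.2 (by simp)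
  rw [dim, this, map_zero, Complex.zero_re]

omit [CompleteSpace H] [Fintype ι] [DecidableEq ι] in
lemma isClosed_comap_coord {S : Submodule ℂ H} (h : IsClosed (S : Set H)) (i : ι) :
    IsClosed (S.comap (coord i).toLinearMap : Set (PiLp 2 (fun _ : ι => H))) :=
  h.preimage (coord i).continuous

/-- Rank-nullity for a coordinate map restricted to a closed invariant subspace. -/
lemma dim_eq_dim_map_add {Γ : Submodule ℂ (PiLp 2 (fun _ : ι => H))} (hΓ : (T.matrix ι).Inv Γ)
    (hc : IsClosed (Γ : Set (PiLp 2 (fun _ : ι => H)))) (i : ι) :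
    (T.matrix ι).dim Γ = T.dim (Γ.map (coord i).toLinearMap) +
      (T.matrix ι).dim (Γ ⊓ (⊥ : Submodule ℂ H).comap (coord i).toLinearMap) := by
  have h := dim_inf_add_dim_sup hΓ (inv_bot.comap_coord i) hc
    (isClosed_comap_coord (by simp) i)
  have h2 : Γ ⊔ (⊥ : Submodule ℂ H).comap (coord i).toLinearMap =
      (Γ.map (coord i).toLinearMap).comap (coord i).toLinearMap := by
    rw [Submodule.comap_map_eq]
    rfl
  rw [h2, dim_comap_coord, dim_comap_coord, dim_bot] at h
  linarith

/-- If the `i`-th coordinate is injective on `Γ`, the elements of `Γ` whose `i`-th coordinate lies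
in `p` have `i`-th coordinates dense in `p`. -/
lemma dense_map_inf_comap {Γ : Submodule ℂ (PiLp 2 (fun _ : ι => H))} (hΓ : (T.matrix ι).Inv Γ)
    (hc : IsClosed (Γ : Set (PiLp 2 (fun _ : ι => H)))) {i : ι}
    (hinj : Γ ⊓ (⊥ : Submodule ℂ H).comap (coord i).toLinearMap = ⊥)
    {p : Submodule ℂ H} (hp : T.Inv p) (hpc : IsClosed (p : Set H))
    (hle : p ≤ (Γ.map (coord i).toLinearMap).topologicalClosure) :
    p ≤ ((Γ ⊓ p.comap (coord i).toLinearMap).map (coord i).toLinearMap).topologicalClosure := by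
  set E := Γ.map (coord i).toLinearMap with hE
  have hEinv : T.Inv E := hΓ.map_coord i
  have hpi := hp.comap_coord (ι := ι) i
  have hΓp := hΓ.inf hpi
  have hpc' := isClosed_comap_coord (ι := ι) hpc i
  have h1 := dim_inf_add_dim_sup hΓ hpi hc hpc'
  have h2 : (T.matrix ι).dim (Γ ⊔ p.comap (coord i).toLinearMap) ≤
      (T.matrix ι).dim (E.comap (coord i).toLinearMap) := by
    refine dim_mono (hΓ.sup hpi) (hEinv.comap_coord i) ?_
    rw [topologicalClosure_comap_coord]
    refine sup_le (fun w hw => ?_) (Submodule.comap_mono hle)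
    exact E.le_topologicalClosure ⟨w, hw, rfl⟩
  have h3 := dim_eq_dim_map_add hΓ hc i
  have h4 := dim_eq_dim_map_add hΓp (hc.inter hpc') i
  rw [inf_right_comm, hinj, bot_inf_eq, dim_bot] at h4
  rw [hinj, dim_bot] at h3
  rw [dim_comap_coord] at h2
  rw [dim_comap_coord] at h1
  refine le_closure_of_dim_le (hΓp.map_coord i) hp ?_ (by linarith)
  refine le_trans ?_ p.le_topologicalClosure
  rintro _ ⟨w, hw, rfl⟩
  exact hw.2

end CommutantTrace

end Amplification

section Relation

namespace CommutantTrace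

variable {H : Type*} [NormedAddCommGroup H] [InnerProductSpace ℂ H] [CompleteSpace H]
variable {T : CommutantTrace H}

/-- The pairs whose `i`-th coordinate vanishes. -/
noncomputable def kerCoord (H : Type*) [NormedAddCommGroup H] [InnerProductSpace ℂ H] (i : Fin 2) :
    Submodule ℂ (PiLp 2 (fun _ : Fin 2 => H)) :=
  (⊥ : Submodule ℂ H).comap (coord i).toLinearMap

/-- The `j`-th coordinates of the elements of the relation `Γ` whose `i`-th coordinate is in `p`. -/
noncomputable def transport (Γ : Submodule ℂ (PiLp 2 (fun _ : Fin 2 => H))) (i j : Fin 2)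
    (p : Submodule ℂ H) : Submodule ℂ H :=
  (Γ ⊓ p.comap (coord i).toLinearMap).map (coord j).toLinearMap

variable {Γ : Submodule ℂ (PiLp 2 (fun _ : Fin 2 => H))}

lemma Inv.transport (hΓ : (T.matrix (Fin 2)).Inv Γ) {p : Submodule ℂ H} (hp : T.Inv p)
    (i j : Fin 2) : T.Inv (transport Γ i j p) :=
  (hΓ.inf (hp.comap_coord i)).map_coord j

omit [CompleteSpace H] in
lemma transport_le (p : Submodule ℂ H) (i : Fin 2) :
    CommutantTrace.transport Γ i i p ≤ p := by
  rintro _ ⟨w, hw, rfl⟩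
  exact hw.2

omit [CompleteSpace H] in
lemma transport_mono {p p' : Submodule ℂ H} (h : p ≤ p') (i j : Fin 2) :
    CommutantTrace.transport Γ i j p ≤ CommutantTrace.transport Γ i j p' :=
  Submodule.map_mono (inf_le_inf_left _ (Submodule.comap_mono h))

omit [CompleteSpace H] in
/-- Going back and forth along a relation enlarges a transported subspace. -/
lemma transport_le_transport {p q : Submodule ℂ H} {i j : Fin 2}
    (h : CommutantTrace.transport Γ i j p ≤ q) (k : Fin 2) :
    CommutantTrace.transport Γ i k p ≤ CommutantTrace.transport Γ j k q :=
  Submodule.map_mono fun w hw => ⟨hw.1, h ⟨w, hw, rfl⟩⟩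

lemma dim_transport_add (hΓ : (T.matrix (Fin 2)).Inv Γ)
    (hc : IsClosed (Γ : Set (PiLp 2 (fun _ : Fin 2 => H)))) (h0 : Γ ⊓ kerCoord H 0 = ⊥)
    {p : Submodule ℂ H} (hp : T.Inv p) (hpc : IsClosed (p : Set H))
    (hle : p ≤ (Γ.map (coord 0).toLinearMap).topologicalClosure) :
    T.dim p = T.dim (transport Γ 0 1 p) + T.dim (transport (Γ ⊓ kerCoord H 1) 0 0 p) := by
  have hd := dense_map_inf_comap hΓ hc h0 hp hpc hle
  have hS := hΓ.inf (hp.comap_coord 0)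
  have hSc : IsClosed ((Γ ⊓ p.comap (coord 0).toLinearMap :
      Submodule ℂ (PiLp 2 (fun _ : Fin 2 => H))) : Set (PiLp 2 (fun _ : Fin 2 => H))) :=
    hc.inter (isClosed_comap_coord hpc 0)
  have e0 := dim_eq_dim_map_add hS hSc 0
  have e1 := dim_eq_dim_map_add hS hSc 1
  have hk := hΓ.inf (inv_bot.comap_coord (T := T) (1 : Fin 2))
  have e2 := dim_eq_dim_map_add (hk.inf (hp.comap_coord 0))
    ((hc.inter (isClosed_comap_coord (by simp) 1)).inter (isClosed_comap_coord hpc 0)) 0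
  change _ = _ + (T.matrix (Fin 2)).dim (_ ⊓ kerCoord H 0) at e0 e2
  rw [inf_right_comm, h0, bot_inf_eq, dim_bot] at e0
  rw [inf_right_comm Γ, inf_right_comm _ _ (kerCoord H 0), inf_right_comm Γ _ (kerCoord H 0), h0,
    bot_inf_eq, bot_inf_eq, dim_bot] at e2
  have e3 : T.dim p = T.dim (transport Γ 0 0 p) :=
    (dim_mono hp (hΓ.transport hp 0 0) hd).antisymm
      (dim_mono (hΓ.transport hp 0 0) hp ((transport_le p 0).trans p.le_topologicalClosure))
  simp only [transport, kerCoord] at e3 ⊢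
  rw [inf_right_comm Γ]
  linarith

variable (hΓ : (T.matrix (Fin 2)).Inv Γ)
  (hc : IsClosed (Γ : Set (PiLp 2 (fun _ : Fin 2 => H))))
  (h0 : Γ ⊓ kerCoord H 0 = ⊥) (h1 : Γ ⊓ kerCoord H 1 = ⊥)

include hΓ hc h0 h1

lemma dim_transport {p : Submodule ℂ H} (hp : T.Inv p) (hpc : IsClosed (p : Set H))
    (hle : p ≤ (Γ.map (coord 0).toLinearMap).topologicalClosure) :
    T.dim (transport Γ 0 1 p) = T.dim p := by
  have h := dim_transport_add hΓ hc h0 hp hpc hle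
  rw [h1] at h
  simpa [transport, dim_bot] using h.symm

lemma dim_transport_zero_eq_one {q : Submodule ℂ H} (hq : T.Inv q) (hqc : IsClosed (q : Set H)) :
    T.dim (transport Γ 1 0 q) = T.dim (transport Γ 1 1 q) := by
  have hS := hΓ.inf (hq.comap_coord 1)
  have hSc : IsClosed ((Γ ⊓ q.comap (coord 1).toLinearMap :
      Submodule ℂ (PiLp 2 (fun _ : Fin 2 => H))) : Set (PiLp 2 (fun _ : Fin 2 => H))) :=
    hc.inter (isClosed_comap_coord hqc 1)
  have e0 := dim_eq_dim_map_add hS hSc 0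
  have e1 := dim_eq_dim_map_add hS hSc 1
  change _ = _ + (T.matrix (Fin 2)).dim (_ ⊓ kerCoord H 0) at e0
  change _ = _ + (T.matrix (Fin 2)).dim (_ ⊓ kerCoord H 1) at e1
  rw [inf_right_comm, h0, bot_inf_eq, dim_bot] at e0
  rw [inf_right_comm, h1, bot_inf_eq, dim_bot] at e1
  simp only [transport]
  linarith

lemma le_of_transport_le {p₁ p₂ : Submodule ℂ H} (hp₁ : T.Inv p₁) (hp₂ : T.Inv p₂)
    (hc₁ : IsClosed (p₁ : Set H)) (hc₂ : IsClosed (p₂ : Set H))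
    (hle₁ : p₁ ≤ (Γ.map (coord 0).toLinearMap).topologicalClosure)
    (hle₂ : p₂ ≤ (Γ.map (coord 0).toLinearMap).topologicalClosure)
    (h : transport Γ 0 1 p₁ ≤ (transport Γ 0 1 p₂).topologicalClosure) : p₁ ≤ p₂ := by
  set q := (transport Γ 0 1 p₂).topologicalClosure with hqdef
  have hq : T.Inv q := (hΓ.transport hp₂ 0 1).closure
  have hqc : IsClosed (q : Set H) := Submodule.isClosed_topologicalClosure _
  have h3 : p₁ ≤ (transport Γ 1 0 q).topologicalClosure :=
    (dense_map_inf_comap hΓ hc h0 hp₁ hc₁ hle₁).trans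
      (Submodule.topologicalClosure_mono (transport_le_transport h 0))
  have h4 : p₂ ≤ (transport Γ 1 0 q).topologicalClosure :=
    (dense_map_inf_comap hΓ hc h0 hp₂ hc₂ hle₂).trans
      (Submodule.topologicalClosure_mono
        (transport_le_transport (Submodule.le_topologicalClosure _) 0))
  have h5 : T.dim (transport Γ 1 0 q) ≤ T.dim p₂ := by
    rw [dim_transport_zero_eq_one hΓ hc h0 h1 hq hqc, ← dim_transport hΓ hc h0 h1 hp₂ hc₂ hle₂]
    exact dim_mono (hΓ.transport hq 1 1) (hΓ.transport hp₂ 0 1) (transport_le q 1)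
  have h6 := le_closure_of_dim_le hp₂ (hΓ.transport hq 1 0) h4 h5
  rw [topologicalClosure_eq_self hc₂] at h6
  exact h3.trans (Submodule.topologicalClosure_minimal _ h6 hc₂)

lemma closure_transport_transport {q : Submodule ℂ H} (hq : T.Inv q) (hqc : IsClosed (q : Set H))
    (hle : q ≤ (Γ.map (coord 1).toLinearMap).topologicalClosure) :
    (transport Γ 0 1 (transport Γ 1 0 q).topologicalClosure).topologicalClosure = q := by
  set p := (transport Γ 1 0 q).topologicalClosure with hpdef
  have hp : T.Inv p := (hΓ.transport hq 1 0).closure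
  have hpc : IsClosed (p : Set H) := Submodule.isClosed_topologicalClosure _
  have h2 : q ≤ (transport Γ 0 1 p).topologicalClosure :=
    (dense_map_inf_comap hΓ hc h1 hq hqc hle).trans
      (Submodule.topologicalClosure_mono
        (transport_le_transport (Submodule.le_topologicalClosure _) 1))
  have hple : p ≤ (Γ.map (coord 0).toLinearMap).topologicalClosure :=
    Submodule.topologicalClosure_mono (Submodule.map_mono inf_le_left)
  have h3 : T.dim (transport Γ 0 1 p) ≤ T.dim q := by
    rw [dim_transport hΓ hc h0 h1 hp hpc hple, hpdef,
      dim_congr (topologicalClosure_eq_self (Submodule.isClosed_topologicalClosure _)),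
      dim_transport_zero_eq_one hΓ hc h0 h1 hq hqc]
    exact dim_mono (hΓ.transport hq 1 1) hq ((transport_le q 1).trans q.le_topologicalClosure)
  have h4 := le_closure_of_dim_le hq (hΓ.transport hp 0 1) h2 h3
  rw [topologicalClosure_eq_self hqc] at h4
  exact (Submodule.topologicalClosure_minimal _ h4 hqc).antisymm h2

end CommutantTrace

end Relation

section VonNeumann

namespace Paper

variable {H : Type} [NormedAddCommGroup H] [InnerProductSpace ℂ H] [CompleteSpace H]

lemma IsProj.isStarProjection {p : H →L[ℂ] H} (hp : IsProj p) : IsStarProjection p :=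
  ⟨hp.1, hp.2⟩

lemma IsProj.mem_rng_iff {p : H →L[ℂ] H} (hp : IsProj p) {x : H} : x ∈ rng p ↔ p x = x := by
  constructor
  · rintro ⟨y, rfl⟩
    exact congr($(hp.1.eq) y)
  · exact fun h => ⟨x, h⟩

lemma IsProj.isClosed_rng {p : H →L[ℂ] H} (hp : IsProj p) : IsClosed (rng p : Set H) := by
  have : (rng p : Set H) = {x | p x = x} := Set.ext fun x => hp.mem_rng_iff
  rw [this]
  exact isClosed_eq p.continuous continuous_id

lemma IsProj.eq_closureProj {p : H →L[ℂ] H} (hp : IsProj p) : p = closureProj (rng p) :=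
  hp.isStarProjection.eq_closureProj (topologicalClosure_eq_self hp.isClosed_rng).symm

lemma isProj_closureProj (S : Submodule ℂ H) : IsProj (closureProj S) :=
  ⟨(isStarProjection_closureProj S).isIdempotentElem, (isStarProjection_closureProj S).isSelfAdjoint⟩

lemma rng_closureProj (S : Submodule ℂ H) : rng (closureProj S) = S.topologicalClosure :=
  Submodule.range_starProjection _

lemma IsProj.eq_of_rng_eq {p q : H →L[ℂ] H} (hp : IsProj p) (hq : IsProj q)
    (h : rng p = rng q) : p = q := by
  rw [hp.eq_closureProj, hq.eq_closureProj, h]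

lemma mem_of_commute_unitary (M : VonNeumannAlgebra H) {a : H →L[ℂ] H}
    (h : ∀ u ∈ M.commutant, u * star u = 1 → star u * u = 1 → u * a = a * u) : a ∈ M := by
  rw [← M.commutant_commutant, VonNeumannAlgebra.mem_commutant_iff]
  intro b hb
  let N := M.commutant.toStarSubalgebra
  have hcl : IsClosed (N : Set (H →L[ℂ] H)) := by
    change IsClosed (M.commutant : Set (H →L[ℂ] H))
    rw [VonNeumannAlgebra.coe_commutant]
    exact Set.isClosed_centralizer _
  let _ : CStarAlgebra N := StarSubalgebra.cstarAlgebra N (h_closed := hcl)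
  obtain ⟨u, c, hu, -⟩ := CStarAlgebra.exists_sum_four_unitary (⟨b, hb⟩ : N)
  have hb' : b = ∑ i, c i • ((u i : N) : H →L[ℂ] H) := by
    have := congrArg N.subtype hu
    simpa [map_sum] using this
  rw [hb', Finset.sum_mul, Finset.mul_sum]
  refine Finset.sum_congr rfl fun i _ => ?_
  rw [smul_mul_assoc, mul_smul_comm, h _ (u i : N).2]
  · exact congrArg Subtype.val (Unitary.mul_star_self_of_mem (u i).2)
  · exact congrArg Subtype.val (Unitary.star_mul_self_of_mem (u i).2)

/-- The unitaries of the commutant of a von Neumann algebra. -/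
def commutantUnitaries (M : VonNeumannAlgebra H) : Set (H →L[ℂ] H) :=
  {u | u ∈ M.commutant ∧ u * star u = 1 ∧ star u * u = 1}

lemma mem_centralizer_commutantUnitaries {M : VonNeumannAlgebra H} {a : H →L[ℂ] H} :
    a ∈ Subring.centralizer (commutantUnitaries M) ↔ a ∈ M := by
  rw [Subring.mem_centralizer_iff]
  constructor
  · exact fun h => mem_of_commute_unitary M fun u h1 h2 h3 => h u ⟨h1, h2, h3⟩
  · exact fun h u hu => (VonNeumannAlgebra.mem_commutant_iff.1 hu.1 a h).symm

/-- A tracial state on a von Neumann algebra as a trace on the commutant of a set. -/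
def TracialState.toCommutantTrace {M : VonNeumannAlgebra H} (T : TracialState M) :
    CommutantTrace H where
  gens := commutantUnitaries M
  star_mem := fun b hb => ⟨star_mem hb.1, by rw [star_star]; exact hb.2.2,
    by rw [star_star]; exact hb.2.1⟩
  tr := AddMonoidHom.mk' T.τ T.map_add
  tracial := fun a b ha hb => T.tracial a b (mem_centralizer_commutantUnitaries.1 ha)
    (mem_centralizer_commutantUnitaries.1 hb)
  pos := fun a ha => T.pos a (mem_centralizer_commutantUnitaries.1 ha)
  faithful := fun a ha => T.faithful a (mem_centralizer_commutantUnitaries.1 ha)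

variable {M : VonNeumannAlgebra H} (T : TracialState M)

lemma inv_rng {p : H →L[ℂ] H} (hp : p ∈ M) : T.toCommutantTrace.Inv (rng p) := by
  rintro b hb _ ⟨x, rfl⟩
  exact ⟨b x, congr($(VonNeumannAlgebra.mem_commutant_iff.1 hb.1 p hp) x)⟩

variable {T}

lemma closureProj_mem {S : Submodule ℂ H} (hS : T.toCommutantTrace.Inv S) : closureProj S ∈ M :=
  mem_centralizer_commutantUnitaries.1 hS.closureProj_mem

lemma IsProjection.trace_eq {p : H →L[ℂ] H} (hp : IsProjection M p) :
    T.τ p = T.toCommutantTrace.dim (rng p) := by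
  rw [← (inv_rng T hp.1).tr_eq, ← hp.2.eq_closureProj]
  rfl

/-- The graph of a partially defined operator inside the Hilbert sum of two copies of `H`. -/
noncomputable def graphSum (X : H →ₗ.[ℂ] H) : Submodule ℂ (PiLp 2 (fun _ : Fin 2 => H)) :=
  X.graph.comap ((coord 0).prod (coord 1)).toLinearMap

omit [CompleteSpace H] in
lemma mem_graphSum {X : H →ₗ.[ℂ] H} {w : PiLp 2 (fun _ : Fin 2 => H)} :
    w ∈ graphSum X ↔ ∃ x : X.domain, (x : H) = coord 0 w ∧ X x = coord 1 w := by
  change (coord 0 w, coord 1 w) ∈ X.graph ↔ _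
  rw [LinearPMap.mem_graph_iff]

lemma exists_mem_graphSum {X : H →ₗ.[ℂ] H} (x : X.domain) :
    ∃ w ∈ graphSum X, coord 0 w = x ∧ coord 1 w = X x := by
  refine ⟨incl 0 (x : H) + incl 1 (X x), mem_graphSum.2 ⟨x, ?_, ?_⟩, ?_, ?_⟩ <;>
    simp [coord_incl]

end Paper

end VonNeumann

section Sharp

namespace Paper

open CommutantTrace

variable {H : Type} [NormedAddCommGroup H] [InnerProductSpace ℂ H] [CompleteSpace H]
variable {M : VonNeumannAlgebra H} {T : TracialState M} {X : H →ₗ.[ℂ] H} {k R : H →L[ℂ] H}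

lemma coe_transport_graphSum (S : Submodule ℂ H) :
    (transport (graphSum X) 0 1 S : Set H) = imageSet X S := by
  ext y
  constructor
  · rintro ⟨w, ⟨hw, hS⟩, rfl⟩
    obtain ⟨x, hx, hy⟩ := mem_graphSum.1 hw
    exact ⟨x, hx ▸ hS, hy⟩
  · rintro ⟨x, hx, rfl⟩
    obtain ⟨w, hw, h0, h1⟩ := exists_mem_graphSum x
    exact ⟨w, ⟨hw, by simpa [h0] using hx⟩, h1⟩

lemma isSharp_iff {p q : H →L[ℂ] H} :
    IsSharp X p q ↔
      IsProj q ∧ rng q = (transport (graphSum X) 0 1 (rng p)).topologicalClosure := by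
  rw [IsSharp, ← SetLike.coe_set_eq (p := rng q), Submodule.topologicalClosure_coe, coe_transport_graphSum]

lemma IsRanProj.rng_eq (hR : IsRanProj X R) :
    rng R = ((graphSum X).map (coord 1).toLinearMap).topologicalClosure := by
  have h : (graphSum X).map (coord 1).toLinearMap = transport (graphSum X) 0 1 ⊤ := by
    rw [transport, Submodule.comap_top, inf_top_eq]
  rw [h, ← SetLike.coe_set_eq, Submodule.topologicalClosure_coe, coe_transport_graphSum,
    Submodule.top_coe]
  exact hR.2

lemma Affiliated.inv_graphSum (haff : Affiliated M X) (T : TracialState M) :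
    (T.toCommutantTrace.matrix (Fin 2)).Inv (graphSum X) := by
  rintro _ ⟨u, ⟨hu, h1, h2⟩, rfl⟩ w hw
  obtain ⟨x, hx, hy⟩ := mem_graphSum.1 hw
  obtain ⟨h, he⟩ := haff.2.2 u hu h1 h2 x
  refine mem_graphSum.2 ⟨⟨u x, h⟩, ?_, ?_⟩
  · rw [coord_diag, ← hx]
  · rw [coord_diag, ← hy, he]

lemma Affiliated.isClosed_graphSum (haff : Affiliated M X) :
    IsClosed (graphSum X : Set (PiLp 2 (fun _ : Fin 2 => H))) :=
  haff.2.1.preimage ((coord 0).prod (coord 1)).continuous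

omit [CompleteSpace H] in
lemma coord_ext {w w' : PiLp 2 (fun _ : Fin 2 => H)} (h0 : coord 0 w = coord 0 w')
    (h1 : coord 1 w = coord 1 w') : w = w' := by
  ext i
  fin_cases i
  · exact h0
  · exact h1

omit [CompleteSpace H] in
lemma graphSum_inf_kerCoord_zero : graphSum X ⊓ kerCoord H 0 = ⊥ := by
  refine (Submodule.eq_bot_iff _).2 fun w hw => ?_
  obtain ⟨x, hx, hy⟩ := mem_graphSum.1 hw.1
  have h0 : coord 0 w = 0 := hw.2
  have hx0 : x = 0 := Subtype.ext (hx.trans h0)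
  refine coord_ext (h0.trans (map_zero _).symm) ?_
  rw [← hy, hx0, LinearPMap.map_zero, map_zero]

lemma Affiliated.topologicalClosure_map_coord_zero (haff : Affiliated M X) :
    ((graphSum X).map (coord 0).toLinearMap).topologicalClosure = ⊤ := by
  rw [← Submodule.dense_iff_topologicalClosure_eq_top]
  refine haff.1.mono fun x hx => ?_
  obtain ⟨w, hw, h0, -⟩ := exists_mem_graphSum ⟨x, hx⟩
  exact ⟨w, hw, h0⟩

lemma IsKerProj.transport_inf_kerCoord (hk : IsKerProj X k) (S : Submodule ℂ H) :
    transport (graphSum X ⊓ kerCoord H 1) 0 0 S = S ⊓ rng k := by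
  ext x
  rw [Submodule.mem_inf, ← SetLike.mem_coe (p := rng k), hk.2]
  constructor
  · rintro ⟨w, ⟨⟨hw, hw1⟩, hS⟩, rfl⟩
    obtain ⟨x, hx, hy⟩ := mem_graphSum.1 hw
    refine ⟨hS, ?_⟩
    change coord 0 w ∈ _
    rw [← hx]
    exact ⟨x.2, hy.trans hw1⟩
  · rintro ⟨hS, hx, hX⟩
    obtain ⟨w, hw, h0, h1⟩ := exists_mem_graphSum ⟨x, hx⟩
    exact ⟨w, ⟨⟨hw, h1.trans hX⟩, by simpa [h0] using hS⟩, h0⟩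

lemma IsProj.one_sub {p : H →L[ℂ] H} (hp : IsProj p) : IsProj (1 - p) :=
  ⟨hp.1.one_sub, (IsSelfAdjoint.one _).sub hp.2⟩

lemma IsProj.rng_one_sub_inf {p : H →L[ℂ] H} (hp : IsProj p) : rng (1 - p) ⊓ rng p = ⊥ := by
  refine (Submodule.eq_bot_iff _).2 fun x hx => ?_
  have h1 := hp.one_sub.mem_rng_iff.1 hx.1
  have h2 := hp.mem_rng_iff.1 hx.2
  rw [sub_apply, one_apply_eq_self, h2, sub_self] at h1
  exact h1.symm

/-- The part of the graph of `X` lying over the range of `1 - k`. -/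
noncomputable def reducedGraph (X : H →ₗ.[ℂ] H) (k : H →L[ℂ] H) :
    Submodule ℂ (PiLp 2 (fun _ : Fin 2 => H)) :=
  graphSum X ⊓ (rng (1 - k)).comap (coord 0).toLinearMap

lemma Affiliated.inv_reducedGraph (haff : Affiliated M X) (T : TracialState M) (hkM : k ∈ M) :
    (T.toCommutantTrace.matrix (Fin 2)).Inv (reducedGraph X k) :=
  (haff.inv_graphSum T).inf ((inv_rng T (sub_mem (one_mem M) hkM)).comap_coord 0)

lemma Affiliated.isClosed_reducedGraph (haff : Affiliated M X) (hk : IsProj k) :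
    IsClosed (reducedGraph X k : Set (PiLp 2 (fun _ : Fin 2 => H))) :=
  haff.isClosed_graphSum.inter (isClosed_comap_coord hk.one_sub.isClosed_rng 0)

omit [CompleteSpace H] in
lemma reducedGraph_inf_kerCoord_zero : reducedGraph X k ⊓ kerCoord H 0 = ⊥ := by
  rw [reducedGraph, inf_right_comm, graphSum_inf_kerCoord_zero, bot_inf_eq]

lemma IsKerProj.reducedGraph_inf_kerCoord_one (hk : IsKerProj X k) :
    reducedGraph X k ⊓ kerCoord H 1 = ⊥ := by
  refine (Submodule.eq_bot_iff _).2 fun w hw => ?_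
  have h : coord 0 w ∈ rng (1 - k) ⊓ rng k := by
    rw [← hk.transport_inf_kerCoord]
    exact ⟨w, ⟨⟨hw.1.1, hw.2⟩, hw.1.2⟩, rfl⟩
  rw [hk.1.rng_one_sub_inf] at h
  exact coord_ext (((Submodule.mem_bot ℂ).1 h).trans (map_zero _).symm)
    (((Submodule.mem_bot ℂ).1 hw.2).trans (map_zero _).symm)

omit [CompleteSpace H] in
lemma transport_reducedGraph {S : Submodule ℂ H} (h : S ≤ rng (1 - k)) :
    transport (reducedGraph X k) 0 1 S = transport (graphSum X) 0 1 S := by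
  rw [transport, transport, reducedGraph, inf_assoc, ← Submodule.comap_inf, inf_eq_right.2 h]

omit [CompleteSpace H] in
lemma transport_one_zero_reducedGraph_le (S : Submodule ℂ H) :
    transport (reducedGraph X k) 1 0 S ≤ rng (1 - k) := by
  rintro _ ⟨w, hw, rfl⟩
  exact hw.1.2

lemma Affiliated.rng_le_topologicalClosure_map (haff : Affiliated M X) (T : TracialState M)
    (hk : IsProj k) (hkM : k ∈ M) :
    rng (1 - k) ≤ ((reducedGraph X k).map (coord 0).toLinearMap).topologicalClosure :=
  dense_map_inf_comap (haff.inv_graphSum T) haff.isClosed_graphSum graphSum_inf_kerCoord_zero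
    (inv_rng T (sub_mem (one_mem M) hkM)) hk.one_sub.isClosed_rng
    (haff.topologicalClosure_map_coord_zero ▸ le_top)

lemma IsKerProj.map_coord_one_reducedGraph (hk : IsKerProj X k) :
    (reducedGraph X k).map (coord 1).toLinearMap = (graphSum X).map (coord 1).toLinearMap := by
  refine (Submodule.map_mono inf_le_left).antisymm ?_
  rintro _ ⟨w, hw, rfl⟩
  obtain ⟨x, hx, hy⟩ := mem_graphSum.1 hw
  obtain ⟨hkx, hX⟩ : k x ∈ kernelSet X := by
    rw [← hk.2]
    exact ⟨x, rfl⟩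
  obtain ⟨v, hv, h0, h1⟩ := exists_mem_graphSum (x - ⟨k x, hkx⟩)
  refine ⟨v, ⟨hv, ?_⟩, ?_⟩
  · exact ⟨x, h0.symm⟩
  · change coord 1 v = coord 1 w
    rw [h1, LinearPMap.map_sub, hX, sub_zero, hy]

lemma Affiliated.mem_of_isSharp (haff : Affiliated M X) (T : TracialState M) {p q : H →L[ℂ] H}
    (hp : p ∈ M) (h : IsSharp X p q) : q ∈ M := by
  obtain ⟨hq, hpq⟩ := isSharp_iff.1 h
  rw [hq.isStarProjection.eq_closureProj hpq]
  exact closureProj_mem ((haff.inv_graphSum T).transport (inv_rng T hp) 0 1)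

/-- The trace formula for the range projection of `Xp`. -/
lemma Affiliated.trace_eq_sub (haff : Affiliated M X) (hk : IsKerProj X k) {p q m : H →L[ℂ] H}
    (hp : IsProjection M p) (h : IsSharp X p q) (hm : IsMeetOf m p k) (hmM : m ∈ M) :
    T.τ q = T.τ p - T.τ m := by
  obtain ⟨hq, hpq⟩ := isSharp_iff.1 h
  have hd := dim_transport_add (haff.inv_graphSum T) haff.isClosed_graphSum
    graphSum_inf_kerCoord_zero (inv_rng T hp.1) hp.2.isClosed_rng
    (haff.topologicalClosure_map_coord_zero ▸ le_top)
  rw [hk.transport_inf_kerCoord, ← hm.2] at hd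
  have hdq : T.toCommutantTrace.dim (rng q) =
      T.toCommutantTrace.dim (transport (graphSum X) 0 1 (rng p)) :=
    dim_congr ((topologicalClosure_eq_self hq.isClosed_rng).trans hpq)
  rw [IsProjection.trace_eq ⟨haff.mem_of_isSharp T hp.1 h, hq⟩, hp.trace_eq,
    IsProjection.trace_eq ⟨hmM, hm.1⟩, hd, hdq]
  push_cast
  ring

lemma IsSharp.rng_le {p q : H →L[ℂ] H} (h : IsSharp X p q) (hR : IsRanProj X R) : rng q ≤ rng R := by
  rw [(isSharp_iff.1 h).2, hR.rng_eq]
  exact Submodule.topologicalClosure_mono (Submodule.map_mono inf_le_left)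

lemma IsSharp.mono {p₁ p₂ q₁ q₂ : H →L[ℂ] H} (h₁ : IsSharp X p₁ q₁) (h₂ : IsSharp X p₂ q₂)
    (h : rng p₁ ≤ rng p₂) : rng q₁ ≤ rng q₂ := by
  rw [(isSharp_iff.1 h₁).2, (isSharp_iff.1 h₂).2]
  exact Submodule.topologicalClosure_mono (transport_mono h 0 1)

lemma Affiliated.rng_le_of_isSharp (haff : Affiliated M X) (T : TracialState M)
    (hk : IsKerProj X k) (hkM : k ∈ M) {p₁ p₂ q₁ q₂ : H →L[ℂ] H}
    (hp₁ : IsProjection M p₁) (hk₁ : rng p₁ ≤ rng (1 - k))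
    (hp₂ : IsProjection M p₂) (hk₂ : rng p₂ ≤ rng (1 - k))
    (h₁ : IsSharp X p₁ q₁) (h₂ : IsSharp X p₂ q₂) (h : rng q₁ ≤ rng q₂) : rng p₁ ≤ rng p₂ := by
  have hd := haff.rng_le_topologicalClosure_map T hk.1 hkM
  refine le_of_transport_le (haff.inv_reducedGraph T hkM) (haff.isClosed_reducedGraph hk.1)
    reducedGraph_inf_kerCoord_zero hk.reducedGraph_inf_kerCoord_one (inv_rng T hp₁.1)
    (inv_rng T hp₂.1) hp₁.2.isClosed_rng hp₂.2.isClosed_rng (hk₁.trans hd) (hk₂.trans hd) ?_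
  rw [transport_reducedGraph hk₁, transport_reducedGraph hk₂, ← (isSharp_iff.1 h₂).2]
  refine le_trans ?_ h
  rw [(isSharp_iff.1 h₁).2]
  exact Submodule.le_topologicalClosure _

lemma Affiliated.exists_isSharp (haff : Affiliated M X) (T : TracialState M)
    (hk : IsKerProj X k) (hkM : k ∈ M) (hR : IsRanProj X R) {q : H →L[ℂ] H}
    (hq : IsProjection M q) (hqR : rng q ≤ rng R) :
    ∃ p, IsProjection M p ∧ rng p ≤ rng (1 - k) ∧ IsSharp X p q := by
  have hS := (haff.inv_reducedGraph T hkM).transport (inv_rng T hq.1) 1 0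
  have hle : rng (closureProj (transport (reducedGraph X k) 1 0 (rng q))) ≤ rng (1 - k) := by
    rw [rng_closureProj]
    exact Submodule.topologicalClosure_minimal _ (transport_one_zero_reducedGraph_le _)
      hk.1.one_sub.isClosed_rng
  refine ⟨_, ⟨closureProj_mem hS, isProj_closureProj _⟩, hle, isSharp_iff.2 ⟨hq.2, ?_⟩⟩
  rw [← transport_reducedGraph hle, rng_closureProj]
  refine (closure_transport_transport (haff.inv_reducedGraph T hkM)
    (haff.isClosed_reducedGraph hk.1) reducedGraph_inf_kerCoord_zero
    hk.reducedGraph_inf_kerCoord_one (inv_rng T hq.1) hq.2.isClosed_rng ?_).symm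
  rwa [hk.map_coord_one_reducedGraph, ← hR.rng_eq]

end Paper

end Sharp

/-- Let `X` be a closed densely defined operator affiliated with a finite von Neumann algebra
`M` with faithful normal tracial state `τ`, and for a projection `p` let `X♯(p)` denote the
range projection of `Xp`.  Then `X♯` restricts to a trace-preserving lattice (order)
isomorphism from `{p : p ≤ dom-projection of X}` onto `{q : q ≤ range-projection of X}`, and
for any projection `p`, `τ(X♯(p)) = τ(p) − τ(p ∧ ker-projection(X))`. -/
theorem sharp_trace_preserving_lattice_iso {H : Type} [NormedAddCommGroup H]
    [InnerProductSpace ℂ H] [CompleteSpace H] (M : VonNeumannAlgebra H)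
    (T : Paper.TracialState M) (X : H →ₗ.[ℂ] H) (haff : Paper.Affiliated M X)
    (k R : H →L[ℂ] H)
    (hk : Paper.IsKerProj X k) (hkM : k ∈ M)
    (hR : Paper.IsRanProj X R) (hRM : R ∈ M) :
    -- X♯ maps projections under the domain projection to projections of M under the
    -- range projection, preserving the trace:
    (∀ p q : H →L[ℂ] H, Paper.IsProjection M p → Paper.rng p ≤ Paper.rng (1 - k) →
      Paper.IsSharp X p q →
        q ∈ M ∧ Paper.rng q ≤ Paper.rng R ∧ T.τ q = T.τ p) ∧
    -- it is a bijection onto {q : q ≤ range-projection}: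
    (∀ q : H →L[ℂ] H, Paper.IsProjection M q → Paper.rng q ≤ Paper.rng R →
      ∃ p : H →L[ℂ] H,
        (Paper.IsProjection M p ∧ Paper.rng p ≤ Paper.rng (1 - k) ∧ Paper.IsSharp X p q) ∧
        ∀ p' : H →L[ℂ] H,
          Paper.IsProjection M p' → Paper.rng p' ≤ Paper.rng (1 - k) →
            Paper.IsSharp X p' q → p' = p) ∧
    -- it is an order isomorphism (hence a lattice isomorphism):
    (∀ p₁ p₂ q₁ q₂ : H →L[ℂ] H,
      Paper.IsProjection M p₁ → Paper.rng p₁ ≤ Paper.rng (1 - k) →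
      Paper.IsProjection M p₂ → Paper.rng p₂ ≤ Paper.rng (1 - k) →
      Paper.IsSharp X p₁ q₁ → Paper.IsSharp X p₂ q₂ →
        (Paper.rng p₁ ≤ Paper.rng p₂ ↔ Paper.rng q₁ ≤ Paper.rng q₂)) ∧
    -- for any projection p of M, τ(X♯(p)) = τ(p) − τ(p ∧ ker-projection(X)):
    (∀ p q m : H →L[ℂ] H, Paper.IsProjection M p → Paper.IsSharp X p q → q ∈ M →
      Paper.IsMeetOf m p k → m ∈ M → T.τ q = T.τ p - T.τ m) := by
  have trace_zero : T.τ 0 = 0 := by simpa using T.map_smul 0 0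
  refine ⟨fun p q hp hpk h => ⟨haff.mem_of_isSharp T hp.1 h, h.rng_le hR, ?_⟩,
    fun q hq hqR => ?_, fun p₁ p₂ q₁ q₂ hp₁ hk₁ hp₂ hk₂ h₁ h₂ => ⟨h₁.mono h₂,
      haff.rng_le_of_isSharp T hk hkM hp₁ hk₁ hp₂ hk₂ h₁ h₂⟩,
    fun p q m hp h _ hm hmM => haff.trace_eq_sub hk hp h hm hmM⟩
  · have hm : Paper.IsMeetOf 0 p k := by
      refine ⟨⟨IsIdempotentElem.zero, IsSelfAdjoint.zero _⟩, ?_⟩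
      rw [eq_bot_iff.2 ((inf_le_inf_right _ hpk).trans hk.1.rng_one_sub_inf.le), Paper.rng]
      simp
    rw [haff.trace_eq_sub hk hp h hm (zero_mem M), trace_zero, sub_zero]
  · obtain ⟨p, hp, hpk, h⟩ := haff.exists_isSharp T hk hkM hR hq hqR
    refine ⟨p, ⟨hp, hpk, h⟩, fun p' hp' hpk' h' => hp'.2.eq_of_rng_eq hp.2 ?_⟩
    exact (haff.rng_le_of_isSharp T hk hkM hp' hpk' hp hpk h' h le_rfl).antisymm
      (haff.rng_le_of_isSharp T hk hkM hp hpk hp' hpk' h h' le_rfl)
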